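/- There is no continuous function r : ℝ⁵ → ℂ such that for every (a₀, a₁, a₂, a₃, a₄) ∈ ℝ⁵, the value r(a₀, a₁, a₂, a₃, a₄) is a root of the polynomial z⁵ + a₄z⁴ + a₃z³ + a₂z² + a₁z + a₀. -/

import Mathlib

def QRoot (r : ℝ × ℝ × ℝ × ℝ × ℝ → ℂ) : Prop :=
  Continuous r ∧
      ∀ a₀ a₁ a₂ a₃ a₄ : ℝ,
        (r (a₀, a₁, a₂, a₃, a₄)) ^ 5 + (a₄ : ℂ) * (r (a₀, a₁, a₂, a₃, a₄)) ^ 4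
          + (a₃ : ℂ) * (r (a₀, a₁, a₂, a₃, a₄)) ^ 3
          + (a₂ : ℂ) * (r (a₀, a₁, a₂, a₃, a₄)) ^ 2
          + (a₁ : ℂ) * r (a₀, a₁, a₂, a₃, a₄) + (a₀ : ℂ) = 0

lemma gap_lt {f : ℝ → ℝ} (hf : Continuous f) {a b c : ℝ} (hab : a ≤ b)
    (h : ∀ t ∈ Set.Icc a b, f t ≠ c) (ha : f a < c) : f b < c := by
  by_contra hb
  obtain ⟨t, ht, htc⟩ := intermediate_value_Icc hab hf.continuousOn ⟨ha.le, not_lt.mp hb⟩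
  exact h t ht htc

lemma gap_gt {f : ℝ → ℝ} (hf : Continuous f) {a b c : ℝ} (hab : a ≤ b)
    (h : ∀ t ∈ Set.Icc a b, f t ≠ c) (ha : c < f a) : c < f b := by
  have := gap_lt (f := fun t => - f t) hf.neg hab (c := -c)
    (fun t ht e => h t ht (neg_injective e)) (by simpa using ha)
  simpa using this

lemma QRoot.conj {r} (h : QRoot r) : QRoot (fun a => (starRingEnd ℂ) (r a)) := by
  refine ⟨Complex.continuous_conj.comp h.1, fun a₀ a₁ a₂ a₃ a₄ => ?_⟩
  have := congrArg (starRingEnd ℂ) (h.2 a₀ a₁ a₂ a₃ a₄)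
  simpa using this

lemma QRoot.refl {r} (h : QRoot r) :
    QRoot (fun a => - r (-a.1, a.2.1, -a.2.2.1, a.2.2.2.1, -a.2.2.2.2)) := by
  refine ⟨(h.1.comp (by fun_prop)).neg, fun a₀ a₁ a₂ a₃ a₄ => ?_⟩
  have := h.2 (-a₀) a₁ (-a₂) a₃ (-a₄)
  push_cast at this ⊢
  linear_combination -this

/-- the loop of quintics -/
noncomputable def loopC (θ : ℝ) : ℝ × ℝ × ℝ × ℝ × ℝ :=
  ((Real.cos θ - 16) ^ 2 + Real.sin θ ^ 2,
    -16 * Real.sin θ + ((Real.cos θ - 16) ^ 2 + Real.sin θ ^ 2),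
    2 * Real.cos θ + 32 - 16 * Real.sin θ, 2 * Real.cos θ + 32, 1)

lemma loop_cases {r} (h : QRoot r) (θ : ℝ) :
    r (loopC θ) = -1 ∨ (r (loopC θ) - 4 * Complex.I) ^ 2 = -Complex.exp (θ * Complex.I) ∨
      (r (loopC θ) + 4 * Complex.I) ^ 2 = -Complex.exp (-(θ * Complex.I)) := by
  have h0 := h.2 (loopC θ).1 (loopC θ).2.1 (loopC θ).2.2.1 (loopC θ).2.2.2.1 (loopC θ).2.2.2.2
  change (r (loopC θ)) ^ 5 + _ * (r (loopC θ)) ^ 4 + _ * (r (loopC θ)) ^ 3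
    + _ * (r (loopC θ)) ^ 2 + _ * (r (loopC θ)) + _ = 0 at h0
  generalize r (loopC θ) = z at h0 ⊢
  simp only [loopC] at h0
  push_cast at h0
  have e2 : Complex.exp (-(θ * Complex.I)) = Complex.cos θ - Complex.sin θ * Complex.I := by
    rw [← neg_mul, Complex.exp_mul_I, Complex.cos_neg, Complex.sin_neg]; ring
  rw [e2, Complex.exp_mul_I]
  have hI := Complex.I_sq
  generalize Complex.cos (θ : ℂ) = c at *
  generalize Complex.sin (θ : ℂ) = s at *
  have key : (z + 1) * (((z - 4 * Complex.I) ^ 2 + (c + s * Complex.I)) *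
      ((z + 4 * Complex.I) ^ 2 + (c - s * Complex.I))) = 0 := by
    have e1 : (z - 4 * Complex.I) ^ 2 + (c + s * Complex.I)
      = (z ^ 2 - 16 + c) + Complex.I * (s - 8 * z) := by linear_combination 16 * hI
    have e3 : (z + 4 * Complex.I) ^ 2 + (c - s * Complex.I)
      = (z ^ 2 - 16 + c) - Complex.I * (s - 8 * z) := by linear_combination 16 * hI
    rw [e1, e3]
    linear_combination h0 - (z + 1) * (s - 8 * z) ^ 2 * hI
  rcases mul_eq_zero.mp key with k | k
  · left; linear_combination k
  rcases mul_eq_zero.mp k with k | k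
  · right; left; linear_combination k
  · right; right; linear_combination k

lemma up_norm {z : ℂ} {θ : ℝ} (h : (z - 4 * Complex.I) ^ 2 = -Complex.exp (θ * Complex.I)) :
    3 ≤ z.im := by
  have h1 : ‖z - 4 * Complex.I‖ ^ 2 = 1 := by
    rw [← norm_pow, h, norm_neg, Complex.norm_exp_ofReal_mul_I]
  have h2 : ‖z - 4 * Complex.I‖ ≤ 1 := by nlinarith [norm_nonneg (z - 4 * Complex.I)]
  have h3 := (Complex.abs_im_le_norm (z - 4 * Complex.I)).trans h2
  have h4 := (abs_le.mp h3).1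
  simp at h4
  linarith

lemma down_norm {z : ℂ} {θ : ℝ} (h : (z + 4 * Complex.I) ^ 2 = -Complex.exp (-(θ * Complex.I))) :
    z.im ≤ -3 := by
  have := up_norm (z := -z) (θ := -θ) (by
    push_cast; rw [neg_mul, ← h]; ring)
  simp at this
  linarith

lemma loop_not_up {r} (h : QRoot r) : (r (loopC 0)).im < 1 := by
  by_contra hn
  have hc : Continuous fun θ => r (loopC θ) := h.1.comp (by unfold loopC; fun_prop)
  have hne : ∀ θ, (r (loopC θ)).im ≠ 1 := by
    intro θ e
    rcases loop_cases h θ with k | k | k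
    · rw [k] at e; simp at e
    · have := up_norm k; linarith
    · have := down_norm k; linarith
  have h0 : 1 < (r (loopC 0)).im := lt_of_le_of_ne (not_lt.mp hn) (hne 0).symm
  have hup : ∀ θ, 0 ≤ θ → (r (loopC θ) - 4 * Complex.I) ^ 2 = -Complex.exp (θ * Complex.I) := by
    intro θ hθ
    have := gap_gt (Complex.continuous_im.comp hc) hθ (fun t _ => hne t) h0
    simp only [Function.comp] at this
    rcases loop_cases h θ with k | k | k
    · rw [k] at this; simp at this; linarith
    · exact k
    · have := down_norm k; linarith
  let g : ℝ → ℂ := fun θ => (r (loopC θ) - 4 * Complex.I) * Complex.exp (-(θ * Complex.I) / 2)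
  have hg : Continuous g := by
    apply (hc.sub continuous_const).mul
    fun_prop
  have hg2 : ∀ θ, 0 ≤ θ → g θ ^ 2 = -1 := by
    intro θ hθ
    simp only [g]
    rw [mul_pow, hup θ hθ, ← Complex.exp_nat_mul, neg_mul, ← Complex.exp_add]
    have : (θ * Complex.I + ((2 : ℕ) : ℂ) * (-(θ * Complex.I) / 2)) = 0 := by push_cast; ring
    rw [this, Complex.exp_zero]
  have hgne : ∀ θ, 0 ≤ θ → (g θ).im ≠ 0 := by
    intro θ hθ e
    have := congrArg Complex.re (hg2 θ hθ)
    rw [pow_two, Complex.mul_re, e] at this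
    simp at this
    nlinarith [mul_self_nonneg (g θ).re]
  have hper : loopC (2 * Real.pi) = loopC 0 := by simp [loopC]
  have hend : g (2 * Real.pi) = - g 0 := by
    simp only [g, hper]
    have : (-(((2 * Real.pi : ℝ) : ℂ) * Complex.I) / 2) = -(Real.pi * Complex.I) := by
      push_cast; ring
    rw [this, Complex.exp_neg, Complex.exp_pi_mul_I]
    simp
  have hpi : (0 : ℝ) ≤ 2 * Real.pi := by positivity
  have hgi : Continuous fun θ => (g θ).im := Complex.continuous_im.comp hg
  rcases lt_or_gt_of_ne (hgne 0 le_rfl) with k | k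
  · have := gap_lt hgi hpi (fun t ht => hgne t ht.1) k
    simp only [hend, Complex.neg_im] at this; linarith
  · have := gap_gt hgi hpi (fun t ht => hgne t ht.1) k
    simp only [hend, Complex.neg_im] at this; linarith

lemma loop_zero {r} (h : QRoot r) : r (225, 225, 34, 34, 1) = -1 := by
  have e : loopC 0 = (225, 225, 34, 34, 1) := by simp [loopC]; norm_num
  rw [← e]
  have h1 := loop_not_up h
  have h2 := loop_not_up h.conj
  simp only [Complex.conj_im] at h2
  rcases loop_cases h 0 with k | k | k
  · exact k
  · have := up_norm k; linarith
  · have := down_norm k; linarith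

/-- (z+1)(z²+9)(z²-tz+25(1-t)) -/
noncomputable def pathC (t : ℝ) : ℝ × ℝ × ℝ × ℝ × ℝ :=
  (225 * (1 - t), 225 * (1 - t) - 9 * t, 25 * (1 - t) - 9 * t + 9,
    25 * (1 - t) - t + 9, 1 - t)

lemma path_cases {r} (h : QRoot r) {t : ℝ} (ht : t ∈ Set.Icc (0 : ℝ) 1) :
    r (pathC t) = -1 ∨ 0 ≤ (r (pathC t)).re := by
  have h0 := h.2 (pathC t).1 (pathC t).2.1 (pathC t).2.2.1 (pathC t).2.2.2.1 (pathC t).2.2.2.2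
  change (r (pathC t)) ^ 5 + _ * (r (pathC t)) ^ 4 + _ * (r (pathC t)) ^ 3
    + _ * (r (pathC t)) ^ 2 + _ * (r (pathC t)) + _ = 0 at h0
  generalize r (pathC t) = z at h0 ⊢
  simp only [pathC] at h0
  push_cast at h0
  have key : (z + 1) * ((z ^ 2 + 9) * (z ^ 2 - t * z + 25 * (1 - t))) = 0 := by
    linear_combination h0
  have gen : ∀ b c : ℝ, 0 ≤ b → 0 ≤ c → z ^ 2 - b * z + c = 0 → 0 ≤ z.re := by
    intro b c hb hc k
    by_contra hneg
    push Not at hneg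
    have k1 := congrArg Complex.re k
    have k2 := congrArg Complex.im k
    simp [pow_two] at k1 k2
    have k3 : z.im * (2 * z.re - b) = 0 := by linarith
    rcases mul_eq_zero.mp k3 with k4 | k4
    · rw [k4] at k1; nlinarith
    · linarith
  rcases mul_eq_zero.mp key with k | k
  · left; linear_combination k
  right
  rcases mul_eq_zero.mp k with k | k
  · exact gen 0 9 le_rfl (by norm_num) (by push_cast; linear_combination k)
  · exact gen t (25 * (1 - t)) ht.1 (by linarith [ht.2]) (by push_cast; linear_combination k)

lemma path_end {r} (h : QRoot r) : r (0, -9, 0, 8, 0) = -1 := by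
  have e0 : pathC 0 = (225, 225, 34, 34, 1) := by simp [pathC]; norm_num
  have e1 : pathC 1 = (0, -9, 0, 8, 0) := by simp [pathC]; norm_num
  have hc : Continuous fun t => (r (pathC t)).re :=
    Complex.continuous_re.comp (h.1.comp (by unfold pathC; fun_prop))
  have := gap_lt (c := -1/2) hc zero_le_one (fun t ht e => by
    rcases path_cases h ht with k | k
    · rw [k] at e; norm_num at e
    · linarith) (by rw [e0, loop_zero h]; norm_num)
  rw [← e1]
  rcases path_cases h (t := 1) (by simp) with k | k
  · exact k
  · linarith



/-- There is no continuous function `r : ℝ⁵ → ℂ` such that `r (a₀, a₁, a₂, a₃, a₄)` is a root of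
`z⁵ + a₄z⁴ + a₃z³ + a₂z² + a₁z + a₀` for all `(a₀, a₁, a₂, a₃, a₄) ∈ ℝ⁵`. -/
theorem no_continuous_root_quintic_real :
    ¬ ∃ r : ℝ × ℝ × ℝ × ℝ × ℝ → ℂ, Continuous r ∧
      ∀ a₀ a₁ a₂ a₃ a₄ : ℝ,
        (r (a₀, a₁, a₂, a₃, a₄)) ^ 5 + (a₄ : ℂ) * (r (a₀, a₁, a₂, a₃, a₄)) ^ 4
          + (a₃ : ℂ) * (r (a₀, a₁, a₂, a₃, a₄)) ^ 3
          + (a₂ : ℂ) * (r (a₀, a₁, a₂, a₃, a₄)) ^ 2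
          + (a₁ : ℂ) * r (a₀, a₁, a₂, a₃, a₄) + (a₀ : ℂ) = 0 := by
  rintro ⟨r, hr⟩
  have h : QRoot r := hr
  have h1 := path_end h
  have h2 := path_end h.refl
  simp only [neg_zero] at h2
  rw [h1] at h2
  norm_num at h2
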